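/- Let R be a commutative ring that is a ℚ-algebra, A an associative unital R-algebra, and d₁, d₂ ∈ R with d₁² = d₂² = 0; set s = d₁ + d₂ (so s³ = 0). Then for all X, Y ∈ A, exp(s • X) · exp(s • Y) = exp(s • (X + Y) + (s²/2) • [X, Y]), where [X, Y] = X·Y − Y·X. (Paper: Theorem 7.2 = Theorem 8.2, the second-order Baker–Campbell–Hausdorff formula.) -/

import Mathlib

/-- The truncated exponential of a nilpotent element of an `R`-algebra,
where `R` is a commutative `ℚ`-algebra: `∑ₖ aᵏ/k!`, the sum being finite
since `a` is nilpotent.  (For non-nilpotent `a` it takes a junk value.) -/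
noncomputable def nilExp (R : Type*) {A : Type*} [CommRing R] [Algebra ℚ R]
    [Ring A] [Algebra R A] (a : A) : A :=
  ∑ k ∈ Finset.range (nilpotencyClass a), (((k.factorial : ℚ))⁻¹ • (1 : R)) • a ^ k

/-- The commutator bracket `[a, b] = a * b - b * a` in an associative ring. -/
def br {A : Type*} [Ring A] (a b : A) : A := a * b - b * a

theorem nilExp_eq_sum_of_pow_eq_zero {R A : Type*} [CommRing R] [Algebra ℚ R]
    [Ring A] [Algebra R A] {a : A} {n : ℕ} (h : a ^ n = 0) :
    nilExp R a = ∑ k ∈ Finset.range n, (((k.factorial : ℚ))⁻¹ • (1 : R)) • a ^ k := by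
  unfold nilExp
  have hle : nilpotencyClass a ≤ n := Nat.sInf_le h
  refine Finset.sum_subset (Finset.range_mono hle) ?_
  intro k _ hk
  have hk' : nilpotencyClass a ≤ k := by simpa using hk
  rw [pow_eq_zero_of_le hk' (pow_nilpotencyClass ⟨n, h⟩), smul_zero]

theorem nilExp_of_cube {R A : Type*} [CommRing R] [Algebra ℚ R]
    [Ring A] [Algebra R A] {a : A} (h : a ^ 3 = 0) :
    nilExp R a = 1 + a + ((1 / 2 : ℚ) • (1 : R)) • (a * a) := by
  rw [nilExp_eq_sum_of_pow_eq_zero h]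
  simp [Finset.sum_range_succ, pow_two]

theorem bch_aux {R A : Type*} [CommRing R] [Algebra ℚ R]
    [Ring A] [Algebra R A] (s : R) (hs : s ^ 3 = 0) (X Y : A) :
    nilExp R (s • X) * nilExp R (s • Y) =
      nilExp R (s • (X + Y) + ((1 / 2 : ℚ) • s ^ 2) • br X Y) := by
  have hc2 : ((1 / 2 : ℚ) • (1 : R)) + ((1 / 2 : ℚ) • (1 : R)) = 1 := by
    rw [← add_smul]; norm_num
  have ht : (1 / 2 : ℚ) • s ^ 2 = ((1 / 2 : ℚ) • (1 : R)) * s ^ 2 := by simp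
  rw [ht]
  have hX : ∀ W : A, (s • W) ^ 3 = 0 := fun W => by rw [smul_pow, hs, zero_smul]
  generalize hB : br X Y = B
  have hZZ : ∀ c : R, (s • (X + Y) + (c * s ^ 2) • B) * (s • (X + Y) + (c * s ^ 2) • B)
      = (s ^ 2) • ((X + Y) * (X + Y)) := by
    intro c
    have e1 : s * (c * s ^ 2) = 0 := by linear_combination c * hs
    have e2 : (c * s ^ 2) * s = 0 := by linear_combination c * hs
    have e3 : (c * s ^ 2) * (c * s ^ 2) = 0 := by linear_combination c ^ 2 * s * hs
    rw [add_mul, mul_add, mul_add]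
    simp only [smul_mul_smul_comm, e1, e2, e3, zero_smul, add_zero, ← pow_two s]
  have hZ : ∀ c : R, (s • (X + Y) + (c * s ^ 2) • B) ^ 3 = 0 := by
    intro c
    have e1 : s ^ 2 * s = 0 := by linear_combination hs
    have e2 : s ^ 2 * (c * s ^ 2) = 0 := by linear_combination c * s * hs
    rw [pow_succ, pow_two, hZZ, mul_add]
    simp only [smul_mul_smul_comm, e1, e2, zero_smul, add_zero]
  rw [nilExp_of_cube (hX X), nilExp_of_cube (hX Y), nilExp_of_cube (hZ _), hZZ, ← hB]
  generalize ((1 / 2 : ℚ) • (1 : R)) = c at *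
  have e1 : s * (c * (s * s)) = 0 := by linear_combination c * hs
  have e2 : (c * (s * s)) * s = 0 := by linear_combination c * hs
  have e3 : (c * (s * s)) * (c * (s * s)) = 0 := by linear_combination c ^ 2 * s * hs
  simp only [br, add_mul, mul_add, one_mul, mul_one, smul_mul_smul_comm, smul_smul, e1, e2, e3,
    zero_smul, add_zero, smul_add, smul_sub]
  have e4 : s * s = c * s ^ 2 + c * s ^ 2 := by linear_combination -s ^ 2 * hc2
  have e5 : (s * s) • (X * Y) = (c * s ^ 2) • (X * Y) + (c * s ^ 2) • (X * Y) := by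
    rw [← add_smul, ← e4]
  rw [e5]
  simp only [← pow_two s]
  abel

theorem bch_order_two {R A : Type*} [CommRing R] [Algebra ℚ R]
    [Ring A] [Algebra R A] (d₁ d₂ : R) (h₁ : d₁ ^ 2 = 0) (h₂ : d₂ ^ 2 = 0) (X Y : A) :
    nilExp R ((d₁ + d₂) • X) * nilExp R ((d₁ + d₂) • Y) =
      nilExp R ((d₁ + d₂) • (X + Y) + ((1 / 2 : ℚ) • (d₁ + d₂) ^ 2) • br X Y) := by
  refine bch_aux (d₁ + d₂) ?_ X Y
  linear_combination (d₁ + 3 * d₂) * h₁ + (d₂ + 3 * d₁) * h₂
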